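/- arXiv:2202.11251 — 5 statements merged into one kernel-verified Lean document; each statement's English description precedes it below -/
import Mathlib

section
/- Assume the Lanczos setup: A is an n×n real symmetric matrix, Q̂ is an n×n real orthogonal matrix, T̂ := Q̂ᵀAQ̂ is tridiagonal, and b = Q̂e₀; fix k ≤ n and let Q be the first k columns of Q̂. Let M̃ and Ñ be real polynomials with Ñ(λ) > 0 for every eigenvalue λ of A. Then H := Ñ(A) is positive definite, the k×k matrix [Ñ(T̂)]_{:k,:k} is invertible, and the Lanczos-OR iterate Q·([Ñ(T̂)]_{:k,:k})⁻¹·[M̃(T̂)]_{:k,:k}·e₀ minimizes ‖Ñ(A)⁻¹M̃(A)b − x‖_H over all x in the column space of Q. -/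
open Matrix Polynomial

/-- The `H`-norm of a vector: `‖v‖_H = sqrt (vᵀ H v)`. -/
noncomputable def Hnorm {n : ℕ} (H : Matrix (Fin n) (Fin n) ℝ) (v : Fin n → ℝ) : ℝ :=
  Real.sqrt (v ⬝ᵥ (H *ᵥ v))

/-- Orthogonal conjugation commutes with polynomial evaluation. -/
theorem aeval_transpose_mul_mul {n : ℕ} (A Q : Matrix (Fin n) (Fin n) ℝ) (hQ : Qᵀ * Q = 1)
    (p : ℝ[X]) : aeval (Qᵀ * A * Q) p = Qᵀ * aeval A p * Q := by
  have hQ' : Q * Qᵀ = 1 := mul_eq_one_comm.mp hQ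
  induction p using Polynomial.induction_on' with
  | add p q hp hq => simp only [map_add, hp, hq, mul_add, add_mul]
  | monomial m a =>
    have hpow : ∀ m : ℕ, (Qᵀ * A * Q) ^ m = Qᵀ * A ^ m * Q := by
      intro m
      induction m with
      | zero => simp [hQ]
      | succ m ih =>
        rw [pow_succ, ih, pow_succ]
        calc Qᵀ * A ^ m * Q * (Qᵀ * A * Q) = Qᵀ * A ^ m * (Q * Qᵀ) * A * Q := by
              simp only [Matrix.mul_assoc]
          _ = Qᵀ * (A ^ m * A) * Q := by rw [hQ', Matrix.mul_one]; simp only [Matrix.mul_assoc]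
    simp [aeval_monomial, hpow, Algebra.algebraMap_eq_smul_one]

/-- A polynomial which is positive on the spectrum of a symmetric matrix evaluates to a positive
definite matrix. -/
theorem posDef_aeval_of_spectrum_pos {n : ℕ} {A : Matrix (Fin n) (Fin n) ℝ} (hA : A.IsSymm)
    {p : ℝ[X]} (hp : ∀ μ ∈ spectrum ℝ A, 0 < p.eval μ) : (aeval A p).PosDef := by
  have hA' : IsSelfAdjoint A := by
    rw [IsSelfAdjoint, Matrix.star_eq_conjTranspose, Matrix.conjTranspose_eq_transpose_of_trivial]
    exact hA
  have hcfc : cfc p.eval A = aeval A p := cfc_polynomial p A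
  have hH : (aeval A p).IsHermitian := by
    rw [← hcfc]
    exact cfc_predicate p.eval A
  rw [hH.posDef_iff_eigenvalues_pos]
  intro i
  have hi : hH.eigenvalues i ∈ spectrum ℝ (aeval A p) := hH.eigenvalues_mem_spectrum_real i
  have hspec : spectrum ℝ (aeval A p) = p.eval '' spectrum ℝ A := by
    rw [← hcfc, cfc_map_spectrum p.eval A]
  rw [hspec] at hi
  obtain ⟨μ, hμ, h⟩ := hi
  rw [← h]
  exact hp μ hμ

/-- Solutions of the normal equations minimize the distance in the `H`-norm. -/
theorem Hnorm_sub_mulVec_le {n k : ℕ} {H : Matrix (Fin n) (Fin n) ℝ} (hH : H.PosDef)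
    (S : Matrix (Fin n) (Fin k) ℝ) (y : Fin n → ℝ) (x : Fin k → ℝ)
    (hx : Sᵀ *ᵥ (H *ᵥ (y - S *ᵥ x)) = 0) (c : Fin k → ℝ) :
    Hnorm H (y - S *ᵥ x) ≤ Hnorm H (y - S *ᵥ c) := by
  have hsymm : Hᵀ = H := by
    rw [← Matrix.conjTranspose_eq_transpose_of_trivial]
    exact hH.isHermitian
  set r := y - S *ᵥ x with hr
  set d := S *ᵥ (x - c) with hd
  have hy : y - S *ᵥ c = r + d := by
    rw [hr, hd, Matrix.mulVec_sub]
    abel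
  have horth : d ⬝ᵥ (H *ᵥ r) = 0 := by
    rw [hd, dotProduct_comm, Matrix.dotProduct_mulVec, ← Matrix.mulVec_transpose, hx,
      zero_dotProduct]
  have horth' : r ⬝ᵥ (H *ᵥ d) = 0 := by
    rw [Matrix.dotProduct_mulVec, ← Matrix.mulVec_transpose, hsymm, dotProduct_comm, horth]
  have hnonneg : 0 ≤ d ⬝ᵥ (H *ᵥ d) := by
    simpa using hH.posSemidef.dotProduct_mulVec_nonneg d
  rw [hy, Hnorm, Hnorm]
  apply Real.sqrt_le_sqrt
  rw [Matrix.mulVec_add, dotProduct_add, add_dotProduct, add_dotProduct, horth, horth']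
  linarith

theorem stmt_2 {n k : ℕ} (hk0 : 0 < k) (hkn : k ≤ n)
    (A Qhat : Matrix (Fin n) (Fin n) ℝ) (hA : A.IsSymm)
    (hQhat : Qhatᵀ * Qhat = 1)
    (htri : ∀ i j : Fin n, 1 < |(i : ℤ) - (j : ℤ)| → (Qhatᵀ * A * Qhat) i j = 0)
    (b : Fin n → ℝ)
    (hb : b = Qhat *ᵥ Pi.single (⟨0, lt_of_lt_of_le hk0 hkn⟩ : Fin n) 1)
    (Mt Nt : Polynomial ℝ) (hN : ∀ μ ∈ spectrum ℝ A, 0 < Nt.eval μ) :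
    (Polynomial.aeval A Nt).PosDef ∧
    IsUnit ((Polynomial.aeval (Qhatᵀ * A * Qhat) Nt).submatrix
        (Fin.castLE hkn) (Fin.castLE hkn)).det ∧
    ∀ c : Fin k → ℝ,
      Hnorm (Polynomial.aeval A Nt)
        ((Polynomial.aeval A Nt)⁻¹ *ᵥ (Polynomial.aeval A Mt *ᵥ b) -
          Qhat.submatrix id (Fin.castLE hkn) *ᵥ
            (((Polynomial.aeval (Qhatᵀ * A * Qhat) Nt).submatrix
                (Fin.castLE hkn) (Fin.castLE hkn))⁻¹ *ᵥ
              ((Polynomial.aeval (Qhatᵀ * A * Qhat) Mt).submatrix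
                  (Fin.castLE hkn) (Fin.castLE hkn) *ᵥ
                Pi.single (⟨0, hk0⟩ : Fin k) 1))) ≤
      Hnorm (Polynomial.aeval A Nt)
        ((Polynomial.aeval A Nt)⁻¹ *ᵥ (Polynomial.aeval A Mt *ᵥ b) -
          Qhat.submatrix id (Fin.castLE hkn) *ᵥ c) := by
  have hH := posDef_aeval_of_spectrum_pos hA hN
  set S := Qhat.submatrix id (Fin.castLE hkn) with hS
  have hsub : ∀ p : ℝ[X], (aeval (Qhatᵀ * A * Qhat) p).submatrix (Fin.castLE hkn)
      (Fin.castLE hkn) = Sᵀ * aeval A p * S := by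
    intro p
    rw [aeval_transpose_mul_mul A Qhat hQhat p]
    rfl
  have hSS : Sᵀ * S = 1 := by
    have h : Sᵀ * S = (Qhatᵀ * Qhat).submatrix (Fin.castLE hkn) (Fin.castLE hkn) := rfl
    rw [h, hQhat, Matrix.submatrix_one _ (Fin.castLE_injective hkn)]
  have hinj : Function.Injective S.mulVec := by
    intro u v huv
    have h := congrArg (Sᵀ *ᵥ ·) huv
    simpa [Matrix.mulVec_mulVec, hSS] using h
  have hG : (Sᵀ * aeval A Nt * S).PosDef := by
    simpa [Matrix.conjTranspose_eq_transpose_of_trivial] using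
      hH.conjTranspose_mul_mul_same hinj
  have hb' : b = S *ᵥ Pi.single (⟨0, hk0⟩ : Fin k) 1 := by
    rw [hb, Matrix.mulVec_single_one, Matrix.mulVec_single_one]
    rfl
  have hHdet : IsUnit (aeval A Nt).det := (Matrix.isUnit_iff_isUnit_det _).mp hH.isUnit
  have hGdet : IsUnit (Sᵀ * aeval A Nt * S).det := (Matrix.isUnit_iff_isUnit_det _).mp hG.isUnit
  rw [hsub Nt, hsub Mt]
  refine ⟨hH, hGdet, fun c => Hnorm_sub_mulVec_le hH S _ _ ?_ c⟩
  rw [Matrix.mulVec_sub, Matrix.mulVec_sub, sub_eq_zero, hb']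
  simp only [Matrix.mulVec_mulVec]
  congr 1
  calc Sᵀ * (aeval A Nt * ((aeval A Nt)⁻¹ * (aeval A Mt * S)))
      = Sᵀ * aeval A Mt * S := by
        rw [Matrix.mul_nonsing_inv_cancel_left _ _ hHdet, Matrix.mul_assoc]
    _ = (Sᵀ * aeval A Nt * S) * ((Sᵀ * aeval A Nt * S)⁻¹ * (Sᵀ * aeval A Mt * S)) := by
        rw [Matrix.mul_nonsing_inv_cancel_left _ _ hGdet]
    _ = _ := by simp only [Matrix.mul_assoc]
end

section
/- Let A be an n×n real symmetric matrix, b ∈ ℝⁿ, and let M̃, Ñ be real polynomials with Ñ(λ) > 0 for every eigenvalue λ of A, so that H := Ñ(A) is positive definite and r(A) := Ñ(A)⁻¹M̃(A) is defined. Then for every k ≥ 1 and every real polynomial p of degree less than k, the optimal H-norm error from the Krylov subspace satisfies min over x ∈ K_k(A,b) of ‖r(A)b − x‖_H ≤ ‖b‖_H · max over eigenvalues λ of A of |M̃(λ)/Ñ(λ) − p(λ)|. -/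
open Matrix Polynomial

/-- A real symmetric matrix is diagonalised by an orthogonal matrix. -/
theorem Matrix.IsSymm.exists_orthogonal_diagonalization {n : ℕ} {A : Matrix (Fin n) (Fin n) ℝ}
    (hA : A.IsSymm) :
    ∃ (W : Matrix (Fin n) (Fin n) ℝ) (d : Fin n → ℝ), Wᵀ * W = 1 ∧
      (∀ i, d i ∈ spectrum ℝ A) ∧ W * A = diagonal d * W := by
  have hH : A.IsHermitian := by
    rw [Matrix.IsHermitian, conjTranspose_eq_transpose_of_trivial]
    exact hA
  set U : Matrix (Fin n) (Fin n) ℝ := (hH.eigenvectorUnitary).1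
  have h1 : star U * U = 1 := Unitary.coe_star_mul_self _
  have h2 : U * star U = 1 := Unitary.coe_mul_star_self _
  have hs : A = U * diagonal hH.eigenvalues * star U := by
    have := hH.spectral_theorem
    simpa [Unitary.conjStarAlgAut_apply] using this
  refine ⟨star U, hH.eigenvalues, ?_, hH.eigenvalues_mem_spectrum_real, ?_⟩
  · rwa [star_eq_conjTranspose, conjTranspose_eq_transpose_of_trivial, transpose_transpose,
      ← conjTranspose_eq_transpose_of_trivial, ← star_eq_conjTranspose]
  · calc star U * A = star U * (U * diagonal hH.eigenvalues * star U) := by rw [← hs]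
      _ = star U * U * diagonal hH.eigenvalues * star U := by simp only [Matrix.mul_assoc]
      _ = _ := by rw [h1, Matrix.one_mul]

/-- An intertwining with a diagonal matrix passes to polynomials. -/
theorem Matrix.mulVec_aeval_of_mul_eq_diagonal_mul {n : ℕ} {A W : Matrix (Fin n) (Fin n) ℝ}
    {d : Fin n → ℝ} (h : W * A = diagonal d * W) (q : ℝ[X]) (v : Fin n → ℝ) (i : Fin n) :
    (W *ᵥ (aeval A q *ᵥ v)) i = q.eval (d i) * (W *ᵥ v) i := by
  induction q using Polynomial.induction_on' generalizing v with
  | add p q hp hq =>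
    rw [map_add, add_mulVec, mulVec_add, Pi.add_apply, hp, hq, eval_add, add_mul]
  | monomial m a =>
    induction m generalizing v with
    | zero => simp [Algebra.algebraMap_eq_smul_one, smul_mulVec, mulVec_smul]
    | succ m ih =>
      have hAv : (W *ᵥ (A *ᵥ v)) i = d i * (W *ᵥ v) i := by
        rw [mulVec_mulVec, h, ← mulVec_mulVec, mulVec_diagonal]
      have := ih (A *ᵥ v)
      rw [hAv] at this
      rw [← monomial_mul_X, map_mul, aeval_X, ← mulVec_mulVec, this, eval_mul, eval_X]
      ring

/-- `p(A) b` lies in the Krylov subspace of dimension exceeding the degree of `p`. -/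
theorem Matrix.aeval_mulVec_mem_krylov {n : ℕ} (A : Matrix (Fin n) (Fin n) ℝ) (b : Fin n → ℝ)
    {k : ℕ} {p : ℝ[X]} (hp : p.degree < (k : ℕ)) :
    aeval A p *ᵥ b ∈ Submodule.span ℝ (Set.range fun j : Fin k => (A ^ (j : ℕ)) *ᵥ b) := by
  rw [aeval_eq_sum_range, sum_mulVec]
  refine Submodule.sum_mem _ fun j _ => ?_
  rw [smul_mulVec]
  by_cases hj : j < k
  · exact Submodule.smul_mem _ _ (Submodule.subset_span ⟨⟨j, hj⟩, rfl⟩)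
  · rw [coeff_eq_zero_of_degree_lt (hp.trans_le (by exact_mod_cast not_lt.mp hj)), zero_smul]
    exact Submodule.zero_mem _

theorem stmt_3 {n : ℕ} (A : Matrix (Fin n) (Fin n) ℝ) (hA : A.IsSymm) (b : Fin n → ℝ)
    (Mt Nt : Polynomial ℝ) (hN : ∀ μ ∈ spectrum ℝ A, 0 < Nt.eval μ)
    (k : ℕ) (hk : 1 ≤ k) (p : Polynomial ℝ) (hp : p.degree < (k : ℕ)) :
    ∃ x ∈ Submodule.span ℝ (Set.range fun j : Fin k => (A ^ (j : ℕ)) *ᵥ b),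
      Hnorm (Polynomial.aeval A Nt)
          ((Polynomial.aeval A Nt)⁻¹ *ᵥ (Polynomial.aeval A Mt *ᵥ b) - x) ≤
        Hnorm (Polynomial.aeval A Nt) b *
          sSup ((fun μ => |Mt.eval μ / Nt.eval μ - p.eval μ|) '' spectrum ℝ A) := by
  refine ⟨aeval A p *ᵥ b, aeval_mulVec_mem_krylov A b hp, ?_⟩
  obtain ⟨W, d, hW, hd, hWA⟩ := hA.exists_orthogonal_diagonalization
  have key := fun q v i => mulVec_aeval_of_mul_eq_diagonal_mul hWA q v i
  have hpos : ∀ i, 0 < Nt.eval (d i) := fun i => hN _ (hd i)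
  have hunit : IsUnit (aeval A Nt) := by
    rw [← mulVec_injective_iff_isUnit]
    intro u v huv
    have hWuv : W *ᵥ u = W *ᵥ v := by
      funext i
      have h := congrArg (fun w => (W *ᵥ w) i) huv
      simp only [key] at h
      exact mul_left_cancel₀ (hpos i).ne' h
    have h := congrArg (fun w => Wᵀ *ᵥ w) hWuv
    simpa [mulVec_mulVec, hW] using h
  have hform : ∀ v, v ⬝ᵥ (aeval A Nt *ᵥ v) = ∑ i, Nt.eval (d i) * (W *ᵥ v) i ^ 2 := by
    intro v
    calc v ⬝ᵥ (aeval A Nt *ᵥ v) = v ⬝ᵥ (Wᵀ *ᵥ (W *ᵥ (aeval A Nt *ᵥ v))) := by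
          rw [mulVec_mulVec, hW, one_mulVec]
      _ = (W *ᵥ v) ⬝ᵥ (W *ᵥ (aeval A Nt *ᵥ v)) := by
          rw [dotProduct_mulVec, vecMul_transpose]
      _ = _ := Finset.sum_congr rfl fun i _ => by rw [key]; ring
  set S := sSup ((fun μ => |Mt.eval μ / Nt.eval μ - p.eval μ|) '' spectrum ℝ A)
  have hS0 : 0 ≤ S := Real.sSup_nonneg (by rintro _ ⟨μ, -, rfl⟩; exact abs_nonneg _)
  have hS : ∀ i, |Mt.eval (d i) / Nt.eval (d i) - p.eval (d i)| ≤ S := fun i =>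
    le_csSup (A.finite_real_spectrum.image _).bddAbove ⟨d i, hd i, rfl⟩
  have herr : ∀ i, (W *ᵥ ((aeval A Nt)⁻¹ *ᵥ (aeval A Mt *ᵥ b) - aeval A p *ᵥ b)) i =
      (Mt.eval (d i) / Nt.eval (d i) - p.eval (d i)) * (W *ᵥ b) i := by
    intro i
    have h := key Nt ((aeval A Nt)⁻¹ *ᵥ (aeval A Mt *ᵥ b)) i
    rw [mulVec_mulVec _ (aeval A Nt), mul_nonsing_inv _ ((isUnit_iff_isUnit_det _).mp hunit),
      one_mulVec, key] at h
    have := (hpos i).ne'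
    rw [mulVec_sub, Pi.sub_apply, key]
    field_simp
    linear_combination -h
  unfold Hnorm
  rw [← Real.sqrt_sq hS0, ← Real.sqrt_mul' _ (sq_nonneg S), hform, hform]
  refine Real.sqrt_le_sqrt ?_
  rw [Finset.sum_mul]
  refine Finset.sum_le_sum fun i _ => ?_
  rw [herr, mul_pow, mul_assoc, mul_comm ((W *ᵥ b) i ^ 2)]
  have hsq := sq_le_sq' (abs_le.mp (hS i)).1 (abs_le.mp (hS i)).2
  exact mul_le_mul_of_nonneg_left (mul_le_mul_of_nonneg_right hsq (sq_nonneg _)) (hpos i).le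
end

section
/- Let T̂ be an n×n real symmetric tridiagonal matrix, let p be a real polynomial with q := deg(p) ≥ 1, let k ≥ 1, and set k' := k + ⌊q/2⌋, with k' ≤ n. Then the top-left k×k block of p(T̂) equals the top-left k×k block of p([T̂]_{:k',:k'}), where [T̂]_{:k',:k'} is the top-left k'×k' block of T̂. -/
open Matrix Polynomial

/-- The `d`-th power of a tridiagonal matrix vanishes below its `d`-th subdiagonal. -/
theorem tridiagonal_pow_apply_eq_zero {R : Type*} [Semiring R] {n : ℕ}
    {T : Matrix (Fin n) (Fin n) R}
    (htri : ∀ i j : Fin n, 1 < |(i : ℤ) - (j : ℤ)| → T i j = 0)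
    (d : ℕ) {i j : Fin n} (h : (j : ℕ) + d < i) : (T ^ d) i j = 0 := by
  induction d generalizing i with
  | zero =>
    rw [pow_zero, Matrix.one_apply_ne]
    rintro rfl
    omega
  | succ d ih =>
    rw [pow_succ', Matrix.mul_apply]
    refine Finset.sum_eq_zero fun l _ => ?_
    by_cases hl : (j : ℕ) + d < l
    · rw [ih hl, mul_zero]
    · rw [htri i l (lt_abs.2 (Or.inl (by omega))), zero_mul]

/-- An entry of a power of a tridiagonal matrix only depends on a leading principal submatrix,
provided that no walk of the given length between the two indices leaves that submatrix. -/
theorem tridiagonal_pow_castLE {R : Type*} [Semiring R] {m n : ℕ}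
    {T : Matrix (Fin n) (Fin n) R}
    (htri : ∀ i j : Fin n, 1 < |(i : ℤ) - (j : ℤ)| → T i j = 0)
    (hmn : m ≤ n) (d : ℕ) {i j : Fin m} (h : (i : ℕ) + j + d < 2 * m) :
    (T ^ d) (Fin.castLE hmn i) (Fin.castLE hmn j) =
      ((T.submatrix (Fin.castLE hmn) (Fin.castLE hmn)) ^ d) i j := by
  induction d generalizing i with
  | zero => simp [Matrix.one_apply]
  | succ d ih =>
    rw [pow_succ', pow_succ', Matrix.mul_apply, Matrix.mul_apply]
    symm
    refine Fintype.sum_of_injective (Fin.castLE hmn) (Fin.castLE_injective hmn) _ _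
      (fun l hl => ?_) (fun l => ?_)
    · have hml : m ≤ l := by
        by_contra hlt
        exact hl ⟨⟨l, by omega⟩, rfl⟩
      by_cases hil : (i : ℕ) + 1 < l
      · rw [htri _ _ (lt_abs.2 (Or.inr (by simp only [Fin.val_castLE]; omega))), zero_mul]
      · rw [tridiagonal_pow_apply_eq_zero htri d (by simp only [Fin.val_castLE]; omega), mul_zero]
    · rw [Matrix.submatrix_apply]
      by_cases hil : (i : ℕ) + 1 < l
      · rw [htri _ _ (lt_abs.2 (Or.inr (by simp only [Fin.val_castLE]; omega))), zero_mul,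
          zero_mul]
      · rw [ih (by omega)]

theorem stmt_4 {n : ℕ} (T : Matrix (Fin n) (Fin n) ℝ) (hsym : T.IsSymm)
    (htri : ∀ i j : Fin n, 1 < |(i : ℤ) - (j : ℤ)| → T i j = 0)
    (p : Polynomial ℝ) (hq : 1 ≤ p.natDegree)
    (k : ℕ) (hk : 1 ≤ k) (hk' : k + p.natDegree / 2 ≤ n) :
    (Polynomial.aeval T p).submatrix
        (Fin.castLE (le_trans (Nat.le_add_right k (p.natDegree / 2)) hk'))
        (Fin.castLE (le_trans (Nat.le_add_right k (p.natDegree / 2)) hk')) =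
      (Polynomial.aeval (T.submatrix (Fin.castLE hk') (Fin.castLE hk')) p).submatrix
        (Fin.castLE (Nat.le_add_right k (p.natDegree / 2)))
        (Fin.castLE (Nat.le_add_right k (p.natDegree / 2))) := by
  ext i j
  simp only [Polynomial.aeval_eq_sum_range, Matrix.submatrix_apply, Matrix.sum_apply,
    Matrix.smul_apply]
  refine Finset.sum_congr rfl fun d hd => ?_
  rw [Finset.mem_range] at hd
  rw [← tridiagonal_pow_castLE htri hk' d (by simp only [Fin.val_castLE]; omega)]
  rfl
end

section
/- Assume the Lanczos setup: A is an n×n real symmetric matrix, Q̂ is an n×n real orthogonal matrix, T̂ := Q̂ᵀAQ̂ is tridiagonal, and b = Q̂e₀; fix k ≤ n and let Q be the first k columns of Q̂ and T := [T̂]_{:k,:k}. If A is positive definite, then T is positive definite and the CG iterate Q T⁻¹ e₀ minimizes ‖A⁻¹b − x‖_A over all x in the column space of Q. -/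
open Matrix

theorem Hnorm_le_Hnorm_add_of_orthogonal {n : ℕ} {H : Matrix (Fin n) (Fin n) ℝ}
    (hH : H.PosDef) {r d : Fin n → ℝ} (hrd : d ⬝ᵥ (H *ᵥ r) = 0) :
    Hnorm H r ≤ Hnorm H (r + d) := by
  have hdr : r ⬝ᵥ (H *ᵥ d) = 0 := by
    rw [dotProduct_mulVec, ← mulVec_transpose, ← conjTranspose_eq_transpose_of_trivial,
      hH.isHermitian.eq, dotProduct_comm, hrd]
  have hd : 0 ≤ d ⬝ᵥ (H *ᵥ d) := by simpa using hH.posSemidef.dotProduct_mulVec_nonneg d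
  refine Real.sqrt_le_sqrt ?_
  simp only [mulVec_add, dotProduct_add, add_dotProduct, hrd, hdr]
  linarith

/-- The Galerkin approximation of `A⁻¹ b` from the column space of `W` is optimal in the
`A`-norm. -/
theorem Hnorm_galerkin_le {n k : ℕ} {A : Matrix (Fin n) (Fin n) ℝ} (hA : A.PosDef)
    (W : Matrix (Fin n) (Fin k) ℝ) (b : Fin n → ℝ) (hT : IsUnit (Wᵀ * A * W).det)
    (c : Fin k → ℝ) :
    Hnorm A (A⁻¹ *ᵥ b - W *ᵥ ((Wᵀ * A * W)⁻¹ *ᵥ (Wᵀ *ᵥ b))) ≤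
      Hnorm A (A⁻¹ *ᵥ b - W *ᵥ c) := by
  set y := (Wᵀ * A * W)⁻¹ *ᵥ (Wᵀ *ᵥ b) with hy
  have hTy : Wᵀ *ᵥ (A *ᵥ (W *ᵥ y)) = Wᵀ *ᵥ b := by
    rw [mulVec_mulVec, mulVec_mulVec, hy, mulVec_mulVec,
      mul_nonsing_inv _ hT, one_mulVec]
  have hsplit : A⁻¹ *ᵥ b - W *ᵥ c = (A⁻¹ *ᵥ b - W *ᵥ y) + W *ᵥ (y - c) := by
    rw [mulVec_sub]
    abel
  have hAb : A *ᵥ (A⁻¹ *ᵥ b) = b := by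
    rw [mulVec_mulVec, mul_nonsing_inv _ ((isUnit_iff_isUnit_det A).1 hA.isUnit), one_mulVec]
  rw [hsplit]
  refine Hnorm_le_Hnorm_add_of_orthogonal hA ?_
  rw [dotProduct_comm, dotProduct_mulVec, ← mulVec_transpose, mulVec_sub, hAb, mulVec_sub,
    hTy, sub_self, zero_dotProduct]

theorem stmt_10 {n k : ℕ} (hk0 : 0 < k) (hkn : k ≤ n)
    (A Qhat : Matrix (Fin n) (Fin n) ℝ) (hA : A.IsSymm)
    (hQhat : Qhatᵀ * Qhat = 1)
    (htri : ∀ i j : Fin n, 1 < |(i : ℤ) - (j : ℤ)| → (Qhatᵀ * A * Qhat) i j = 0)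
    (b : Fin n → ℝ)
    (hb : b = Qhat *ᵥ Pi.single (⟨0, lt_of_lt_of_le hk0 hkn⟩ : Fin n) 1)
    (hApd : A.PosDef) :
    ((Qhatᵀ * A * Qhat).submatrix (Fin.castLE hkn) (Fin.castLE hkn)).PosDef ∧
    ∀ c : Fin k → ℝ,
      Hnorm A (A⁻¹ *ᵥ b -
          Qhat.submatrix id (Fin.castLE hkn) *ᵥ
            (((Qhatᵀ * A * Qhat).submatrix (Fin.castLE hkn) (Fin.castLE hkn))⁻¹ *ᵥ
              Pi.single (⟨0, hk0⟩ : Fin k) 1)) ≤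
        Hnorm A (A⁻¹ *ᵥ b - Qhat.submatrix id (Fin.castLE hkn) *ᵥ c) := by
  set W := Qhat.submatrix id (Fin.castLE hkn) with hW
  have hT : (Qhatᵀ * A * Qhat).submatrix (Fin.castLE hkn) (Fin.castLE hkn) = Wᵀ * A * W := by
    ext i j
    simp [hW, mul_apply]
  have hWb : Wᵀ *ᵥ b = Pi.single (⟨0, hk0⟩ : Fin k) 1 := by
    have hWQ : Wᵀ * Qhat = (1 : Matrix (Fin n) (Fin n) ℝ).submatrix (Fin.castLE hkn) id := by
      rw [← hQhat]
      ext i j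
      simp [hW, mul_apply]
    ext i
    rw [hb, mulVec_mulVec, hWQ, mulVec_single_one]
    simp [one_apply, Pi.single_apply, Fin.ext_iff]
  have hQinj : Function.Injective Qhat.mulVec := by
    intro x y hxy
    simpa [mulVec_mulVec, hQhat] using congrArg (Qhatᵀ *ᵥ ·) hxy
  have hTpd : ((Qhatᵀ * A * Qhat).submatrix (Fin.castLE hkn) (Fin.castLE hkn)).PosDef := by
    have hThat : (Qhatᵀ * A * Qhat).PosDef := by
      simpa using hApd.conjTranspose_mul_mul_same hQinj
    exact hThat.submatrix (Fin.castLE_injective hkn)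
  refine ⟨hTpd, fun c => ?_⟩
  rw [hT] at hTpd ⊢
  rw [← hWb]
  exact Hnorm_galerkin_le hApd W b ((isUnit_iff_isUnit_det _).1 hTpd.isUnit) c
end

section
/- Assume the Lanczos setup: A is an n×n real symmetric matrix, Q̂ is an n×n real orthogonal matrix, T̂ := Q̂ᵀAQ̂ is tridiagonal, and b = Q̂e₀; fix k < n and let Q be the first k columns of Q̂ and T := [T̂]_{:k,:k}. If A is invertible, then the k×k matrix G := [T̂]_{:k,:k+1}[T̂]_{:k+1,:k} (product of the k×(k+1) and (k+1)×k corner blocks of T̂) is invertible, and the MINRES iterate Q G⁻¹ T e₀ minimizes the residual norm ‖b − Ax‖₂ over all x in the column space of Q. -/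
open Matrix

/-- The Euclidean (2-) norm of a vector. -/
noncomputable def vecNorm {n : ℕ} (v : Fin n → ℝ) : ℝ :=
  Real.sqrt (v ⬝ᵥ v)

/-- A left-invertible real matrix has an invertible Gram matrix. -/
theorem isUnit_det_transpose_mul_self_of_mul_eq_one {m k : Type*} [Fintype m] [Fintype k]
    [DecidableEq k] {B : Matrix m k ℝ} {L : Matrix k m ℝ} (h : L * B = 1) :
    IsUnit (Bᵀ * B).det := by
  have hinj : Function.Injective B.mulVec := fun x y hxy => by
    simpa [mulVec_mulVec, h] using congrArg (L *ᵥ ·) hxy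
  have hpos := (PosDef.conjTranspose_mul_self B hinj).det_pos
  rw [conjTranspose_eq_transpose_of_trivial] at hpos
  exact hpos.ne'.isUnit

/-- A solution of the normal equations minimizes the residual norm. -/
theorem vecNorm_sub_mulVec_le_of_normal_eq {m : ℕ} {k : Type*} [Fintype k]
    {B : Matrix (Fin m) k ℝ} {b : Fin m → ℝ} {x : k → ℝ}
    (hx : (Bᵀ * B) *ᵥ x = Bᵀ *ᵥ b) (c : k → ℝ) :
    vecNorm (b - B *ᵥ x) ≤ vecNorm (b - B *ᵥ c) := by
  apply Real.sqrt_le_sqrt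
  have horth : (b - B *ᵥ x) ⬝ᵥ B *ᵥ (x - c) = 0 := by
    rw [dotProduct_mulVec, ← mulVec_transpose, mulVec_sub, mulVec_mulVec, hx, sub_self,
      zero_dotProduct]
  have hsplit : b - B *ᵥ c = (b - B *ᵥ x) + B *ᵥ (x - c) := by
    rw [mulVec_sub]; abel
  have hnonneg : 0 ≤ B *ᵥ (x - c) ⬝ᵥ B *ᵥ (x - c) :=
    Finset.sum_nonneg fun i _ => mul_self_nonneg _
  rw [hsplit, add_dotProduct, dotProduct_add, dotProduct_add,
    dotProduct_comm (B *ᵥ (x - c)) (b - B *ᵥ x), horth]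
  linarith

/-- For tridiagonal `T`, the leading block of `T * T` only involves the corner blocks of `T`
with one extra row or column. -/
theorem submatrix_mul_self_of_tridiagonal {R : Type*} [NonUnitalNonAssocSemiring R]
    {n k : ℕ} (hkn : k < n) {T : Matrix (Fin n) (Fin n) R}
    (htri : ∀ i j : Fin n, 1 < |(i : ℤ) - (j : ℤ)| → T i j = 0) :
    T.submatrix (Fin.castLE hkn.le) (Fin.castLE hkn) *
        T.submatrix (Fin.castLE hkn) (Fin.castLE hkn.le) =
      (T * T).submatrix (Fin.castLE hkn.le) (Fin.castLE hkn.le) := by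
  ext i j
  simp only [mul_apply, submatrix_apply]
  refine Fintype.sum_of_injective (Fin.castLE hkn) (Fin.castLE_injective _) _ _
    (fun l hl => ?_) fun _ => rfl
  have hkl : k < (l : ℕ) := by
    by_contra! hlk
    exact hl ⟨⟨l, Nat.lt_succ_of_le hlk⟩, rfl⟩
  rw [htri, zero_mul]
  have := i.isLt
  rw [Fin.val_castLE, lt_abs]
  lia

theorem stmt_11 {n k : ℕ} (hk0 : 0 < k) (hkn : k < n)
    (A Qhat : Matrix (Fin n) (Fin n) ℝ) (hA : A.IsSymm)
    (hQhat : Qhatᵀ * Qhat = 1)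
    (htri : ∀ i j : Fin n, 1 < |(i : ℤ) - (j : ℤ)| → (Qhatᵀ * A * Qhat) i j = 0)
    (b : Fin n → ℝ)
    (hb : b = Qhat *ᵥ Pi.single (⟨0, lt_of_lt_of_le hk0 hkn.le⟩ : Fin n) 1)
    (hAinv : IsUnit A.det) :
    IsUnit ((Qhatᵀ * A * Qhat).submatrix (Fin.castLE hkn.le) (Fin.castLE hkn) *
        (Qhatᵀ * A * Qhat).submatrix (Fin.castLE hkn) (Fin.castLE hkn.le)).det ∧
    ∀ c : Fin k → ℝ,
      vecNorm (b - A *ᵥ (Qhat.submatrix id (Fin.castLE hkn.le) *ᵥ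
          (((Qhatᵀ * A * Qhat).submatrix (Fin.castLE hkn.le) (Fin.castLE hkn) *
              (Qhatᵀ * A * Qhat).submatrix (Fin.castLE hkn) (Fin.castLE hkn.le))⁻¹ *ᵥ
            ((Qhatᵀ * A * Qhat).submatrix (Fin.castLE hkn.le) (Fin.castLE hkn.le) *ᵥ
              Pi.single (⟨0, hk0⟩ : Fin k) 1)))) ≤
        vecNorm (b - A *ᵥ (Qhat.submatrix id (Fin.castLE hkn.le) *ᵥ c)) := by
  have hQ' : Qhat * Qhatᵀ = 1 := mul_eq_one_comm.mp hQhat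
  set Q := Qhat.submatrix id (Fin.castLE hkn.le) with hQ
  have hQQ : Qᵀ * Q = 1 := by
    rw [hQ, transpose_submatrix, ← submatrix_mul _ _ _ _ _ Function.bijective_id, hQhat,
      submatrix_one _ (Fin.castLE_injective _)]
  have hG : (Qhatᵀ * A * Qhat).submatrix (Fin.castLE hkn.le) (Fin.castLE hkn) *
      (Qhatᵀ * A * Qhat).submatrix (Fin.castLE hkn) (Fin.castLE hkn.le) =
        (A * Q)ᵀ * (A * Q) := by
    have hsq : Qhatᵀ * A * Qhat * (Qhatᵀ * A * Qhat) = (A * Qhat)ᵀ * (A * Qhat) := by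
      rw [transpose_mul, hA.eq]
      calc _ = Qhatᵀ * A * (Qhat * Qhatᵀ) * (A * Qhat) := by simp only [Matrix.mul_assoc]
        _ = _ := by rw [hQ', Matrix.mul_one]
    rw [submatrix_mul_self_of_tridiagonal hkn htri, hsq]
    rfl
  have hT : (Qhatᵀ * A * Qhat).submatrix (Fin.castLE hkn.le) (Fin.castLE hkn.le) *ᵥ
      Pi.single (⟨0, hk0⟩ : Fin k) 1 = (A * Q)ᵀ *ᵥ b := by
    rw [hb, mulVec_mulVec, transpose_mul, hA.eq, mulVec_single_one, mulVec_single_one]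
    rfl
  have hunit : IsUnit ((A * Q)ᵀ * (A * Q)).det :=
    isUnit_det_transpose_mul_self_of_mul_eq_one (L := Qᵀ * A⁻¹) <| by
      rw [Matrix.mul_assoc, nonsing_inv_mul_cancel_left _ _ hAinv, hQQ]
  rw [hG, hT]
  refine ⟨hunit, fun c => ?_⟩
  rw [mulVec_mulVec _ A Q, mulVec_mulVec c A Q]
  refine vecNorm_sub_mulVec_le_of_normal_eq ?_ c
  rw [mulVec_mulVec, mul_nonsing_inv _ hunit, one_mulVec]
end
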